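/- (Coarse structure) Let w be a hyperbolic isometry of E = ℝⁿ of maximal reflection length ℓ(w) = n + 1, whose min-set is a line with direction vector ν (the 'vertical' direction). Let u be an element of the interval [1,w] and set v = u⁻¹w, so uv = w. Then u and v are not both hyperbolic; if one of u, v is hyperbolic, then the other is an elliptic isometry whose fix-set is invariant under translation by ν; and if both u and v are elliptic, then neither Fix(u) nor Fix(v) is invariant under translation by ν. -/

import Mathlib

open scoped RealInnerProductSpace

noncomputable section

/-- `n`-dimensional euclidean space `E = ℝⁿ` (also used as the vector space `V` of
translations). -/
abbrev Euc (n : ℕ) := EuclideanSpace ℝ (Fin n)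

/-- An isometry of `E`: a surjective distance-preserving map of `E` to itself
(such a map is automatically an affine bijection). -/
abbrev Iso (n : ℕ) := Euc n ≃ᵢ Euc n

/-- The move-set `Mov(w) = { w(x) - x : x ∈ E } ⊆ V`. -/
def MovSet (n : ℕ) (w : Iso n) : Set (Euc n) := {v | ∃ x, w x - x = v}

/-- The fix-set `Fix(w) = { x ∈ E : w(x) = x }`. -/
def FixSet (n : ℕ) (w : Iso n) : Set (Euc n) := {x | w x = x}

/-- A reflection: a nontrivial isometry fixing pointwise an affine hyperplane,
i.e. a nonempty affine subspace of codimension one. -/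
def IsReflection (n : ℕ) (r : Iso n) : Prop :=
  r ≠ 1 ∧ ∃ H : AffineSubspace ℝ (Euc n), (H : Set (Euc n)).Nonempty ∧
    Module.finrank ℝ H.direction + 1 = n ∧ ∀ x ∈ H, r x = x

/-- The reflection length `ℓ(w)`: the least `k` such that `w` is a product of `k`
reflections. -/
def reflLen (n : ℕ) (w : Iso n) : ℕ :=
  sInf {k | ∃ l : List (Iso n), l.length = k ∧ (∀ r ∈ l, IsReflection n r) ∧ l.prod = w}

/-- `u` lies in the interval `[1, w]`:  `ℓ(u) + ℓ(u⁻¹w) = ℓ(w)`. -/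
def inInterval (n : ℕ) (w u : Iso n) : Prop :=
  reflLen n u + reflLen n (u⁻¹ * w) = reflLen n w

/-- The betweenness partial order on the interval `[1, w]`:
`u ≤ v` iff `ℓ(u) + ℓ(u⁻¹v) + ℓ(v⁻¹w) = ℓ(w)`. -/
def intervalLE (n : ℕ) (w u v : Iso n) : Prop :=
  reflLen n u + reflLen n (u⁻¹ * v) + reflLen n (v⁻¹ * w) = reflLen n w

/-- The set of directions `Dir(S) = { m - m' : m, m' ∈ S }` of a subset `S`. -/
def dirSet (n : ℕ) (S : Set (Euc n)) : Set (Euc n) := {d | ∃ m ∈ S, ∃ m' ∈ S, d = m - m'}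

/-- `α` is a root of the reflection `r`: a nonzero vector orthogonal to the
direction space of the fixed hyperplane of `r`. -/
def IsRoot (n : ℕ) (r : Iso n) (α : Euc n) : Prop :=
  α ≠ 0 ∧ ∀ x y : Euc n, r x = x → r y = y → ⟪α, y - x⟫ = 0

open Module

/-- An isometry of `E` has a linear part. -/
theorem Iso.exists_linearPart {n : ℕ} (u : Iso n) :
    ∃ L : Euc n ≃ₗᵢ[ℝ] Euc n, ∀ x y, u x - u y = L (x - y) := by
  refine ⟨u.toRealAffineIsometryEquiv.linearIsometryEquiv, fun x y => ?_⟩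
  have h := u.toRealAffineIsometryEquiv.map_vsub x y
  simpa using h.symm

/-- The linear part of an isometry. -/
def linearPart {n : ℕ} (u : Iso n) : Euc n ≃ₗᵢ[ℝ] Euc n := u.exists_linearPart.choose

theorem linearPart_sub {n : ℕ} (u : Iso n) (x y : Euc n) :
    linearPart u (x - y) = u x - u y := (u.exists_linearPart.choose_spec x y).symm

theorem apply_add_eq {n : ℕ} (u : Iso n) (x d : Euc n) :
    u (x + d) = u x + linearPart u d := by
  have h := linearPart_sub u (x + d) x
  rw [add_sub_cancel_left] at h
  rw [h]; abel

theorem linearPart_mul {n : ℕ} (u v : Iso n) (d : Euc n) :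
    linearPart (u * v) d = linearPart u (linearPart v d) := by
  have h := linearPart_sub (u * v) d 0
  have h' := linearPart_sub v d 0
  rw [sub_zero] at h h'
  rw [h, h', linearPart_sub, IsometryEquiv.mul_apply, IsometryEquiv.mul_apply]

/-- The direction of the move-set: the range of the linear part minus the identity. -/
def moveDir {n : ℕ} (u : Iso n) : Submodule ℝ (Euc n) :=
  LinearMap.range ((linearPart u).toLinearEquiv.toLinearMap - LinearMap.id)

theorem mem_moveDir {n : ℕ} {u : Iso n} {d : Euc n} :
    d ∈ moveDir u ↔ ∃ z, linearPart u z - z = d := by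
  simp [moveDir]

theorem moveDir_mul_le {n : ℕ} (u v : Iso n) : moveDir (u * v) ≤ moveDir u ⊔ moveDir v := by
  intro d hd
  obtain ⟨z, rfl⟩ := mem_moveDir.1 hd
  rw [linearPart_mul, ← sub_add_sub_cancel _ (linearPart v z) z]
  exact Submodule.add_mem_sup (mem_moveDir.2 ⟨_, rfl⟩) (mem_moveDir.2 ⟨_, rfl⟩)

/-- If one displacement lies in the direction of the move-set, the isometry has a fixed point. -/
theorem exists_fixed_of_mem_moveDir {n : ℕ} {u : Iso n} {x : Euc n} (h : u x - x ∈ moveDir u) :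
    ∃ y, u y = y := by
  obtain ⟨z, hz⟩ := mem_moveDir.1 h
  refine ⟨x - z, ?_⟩
  rw [sub_eq_add_neg, apply_add_eq, map_neg, ← sub_eq_zero]
  have : u x + -(linearPart u z) - (x + -z) = (u x - x) - (linearPart u z - z) := by abel
  rw [this, hz, sub_self]

theorem moveDir_le {n : ℕ} {u : Iso n} {S : Submodule ℝ (Euc n)} (hS : ∀ x, u x - x ∈ S) :
    moveDir u ≤ S := by
  intro d hd
  obtain ⟨z, rfl⟩ := mem_moveDir.1 hd
  have h := S.sub_mem (hS z) (hS 0)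
  have e := linearPart_sub u z 0
  rw [sub_zero] at e
  rw [e]
  convert h using 1
  abel

/-- A linear isometry fixes each vector orthogonal to its own displacement. -/
theorem map_eq_self_of_inner_eq_zero {n : ℕ} (L : Euc n ≃ₗᵢ[ℝ] Euc n) {d : Euc n}
    (h : ⟪d, L d - d⟫ = 0) : L d = d := by
  have h1 : ‖d + (L d - d)‖ ^ 2 = ‖d‖ ^ 2 + 2 * ⟪d, L d - d⟫ + ‖L d - d‖ ^ 2 :=
    norm_add_sq_real _ _
  rw [add_sub_cancel, L.norm_map, h] at h1
  have h2 : ‖L d - d‖ = 0 := by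
    have : ‖L d - d‖ ^ 2 = 0 := by linarith
    exact pow_eq_zero_iff (two_ne_zero) |>.1 this
  exact sub_eq_zero.1 (norm_eq_zero.1 h2)

/-- A vector fixed by a linear isometry is orthogonal to all its displacements. -/
theorem inner_map_sub_eq_zero {n : ℕ} (L : Euc n ≃ₗᵢ[ℝ] Euc n) {d : Euc n}
    (h : L d = d) (z : Euc n) : ⟪d, L z - z⟫ = 0 := by
  have h1 := L.inner_map_map d z
  rw [h] at h1
  rw [inner_sub_right, h1, sub_self]

/-- If a linear subspace contains all displacements, the fixed points are stable under
translation by vectors orthogonal to it. -/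
theorem apply_add_of_mem_orthogonal {n : ℕ} {u : Iso n} {S : Submodule ℝ (Euc n)}
    (hS : ∀ x, u x - x ∈ S) {x d : Euc n} (hx : u x = x) (hd : d ∈ Sᗮ) : u (x + d) = x + d := by
  rw [apply_add_eq, hx, map_eq_self_of_inner_eq_zero]
  exact Submodule.inner_left_of_mem_orthogonal (moveDir_le hS (mem_moveDir.2 ⟨d, rfl⟩)) hd

/-- A reflection moves points along a root and fixes an affine hyperplane orthogonal to it. -/
theorem IsReflection.exists_root {n : ℕ} {r : Iso n} (hr : IsReflection n r) :
    ∃ α : Euc n, ∃ c : ℝ, (∀ x, r x - x ∈ Submodule.span ℝ {α}) ∧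
      ∀ y, ⟪α, y⟫ = c → r y = y := by
  obtain ⟨-, H, ⟨h₀, hh₀⟩, hdim, hH⟩ := hr
  have h1 : finrank ℝ H.directionᗮ = 1 := by
    have := H.direction.finrank_add_finrank_orthogonal
    rw [finrank_euclideanSpace_fin] at this
    omega
  obtain ⟨α, hα⟩ := Submodule.finrank_le_one_iff_isPrincipal _ |>.1 h1.le
  refine ⟨α, ⟪α, h₀⟫, fun x => ?_, fun y hy => hH y ?_⟩
  · rw [← hα, Submodule.mem_orthogonal]
    intro d hd
    have hfix : linearPart r d = d := by
      have e := apply_add_eq r h₀ d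
      rw [hH h₀ hh₀, hH (h₀ + d) (by
        rw [add_comm]; exact AffineSubspace.vadd_mem_of_mem_direction hd hh₀)] at e
      exact (add_left_cancel e).symm
    have e : r x - x = linearPart r (x - h₀) - (x - h₀) := by
      rw [linearPart_sub, hH h₀ hh₀]; abel
    rw [e]
    exact inner_map_sub_eq_zero _ hfix _
  · have hmem : y - h₀ ∈ H.direction := by
      rw [← Submodule.orthogonal_orthogonal H.direction, hα,
        Submodule.mem_orthogonal_singleton_iff_inner_right, inner_sub_right, hy, sub_self]
    have := AffineSubspace.vadd_mem_of_mem_direction hmem hh₀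
    simpa using this

/-- All displacements of a product of `k` reflections lie in a linear subspace of dimension at
most `k`, and at most `k - 1` if the product has no fixed point. -/
theorem exists_submodule_of_prod {n : ℕ} (l : List (Iso n)) (hl : ∀ r ∈ l, IsReflection n r) :
    ∃ S : Submodule ℝ (Euc n), (∀ x, l.prod x - x ∈ S) ∧ finrank ℝ S ≤ l.length ∧
      ((¬ ∃ x, l.prod x = x) → finrank ℝ S + 1 ≤ l.length) := by
  induction l with
  | nil => exact ⟨⊥, by simp, by simp, fun h => (h ⟨0, by simp⟩).elim⟩
  | cons r l ih =>
    obtain ⟨S, hS, hdim, hhyp⟩ := ih fun s hs => hl s (List.mem_cons_of_mem _ hs)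
    obtain ⟨α, c, hα, hfix⟩ := (hl r List.mem_cons_self).exists_root
    have hspan : finrank ℝ (Submodule.span ℝ {α}) ≤ 1 := by
      simpa using finrank_span_le_card (R := ℝ) ({α} : Set (Euc n))
    have hsup := Submodule.finrank_add_le_finrank_add_finrank S (Submodule.span ℝ {α})
    refine ⟨S ⊔ Submodule.span ℝ {α}, fun x => ?_, ?_, fun hno => ?_⟩
    · rw [List.prod_cons, IsometryEquiv.mul_apply, ← sub_add_sub_cancel _ (l.prod x) x, sup_comm]
      exact Submodule.add_mem_sup (hα _) (hS x)
    · rw [List.length_cons]; omega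
    · rw [List.length_cons]
      by_cases hl' : ∃ x, l.prod x = x
      · by_cases hmem : α ∈ S
        · rw [sup_eq_left.2 ((Submodule.span_singleton_le_iff_mem _ _).2 hmem)]
          omega
        · exfalso
          obtain ⟨x, hx⟩ := hl'
          have : ∃ d ∈ Sᗮ, ⟪α, d⟫ ≠ 0 := by
            by_contra! h
            apply hmem
            rw [← Submodule.orthogonal_orthogonal S, Submodule.mem_orthogonal']
            exact h
          obtain ⟨d, hd, hαd⟩ := this
          refine hno ⟨x + ((c - ⟪α, x⟫) / ⟪α, d⟫) • d, ?_⟩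
          rw [List.prod_cons, IsometryEquiv.mul_apply,
            apply_add_of_mem_orthogonal hS hx (Submodule.smul_mem _ _ hd)]
          apply hfix
          rw [inner_add_right, real_inner_smul_right, div_mul_cancel₀ _ hαd]
          ring
      · have := hhyp hl'
        omega

/-- `w` is a product of reflections. -/
def IsReflProd {n : ℕ} (w : Iso n) : Prop :=
  ∃ l : List (Iso n), (∀ r ∈ l, IsReflection n r) ∧ l.prod = w

theorem IsReflection.inv {n : ℕ} {r : Iso n} (hr : IsReflection n r) : IsReflection n r⁻¹ := by
  obtain ⟨h1, H, hne, hdim, hH⟩ := hr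
  refine ⟨inv_ne_one.2 h1, H, hne, hdim, fun x hx => ?_⟩
  conv_lhs => rw [← hH x hx]
  exact IsometryEquiv.inv_apply_self r x

theorem IsReflProd.mul {n : ℕ} {u v : Iso n} (hu : IsReflProd u) (hv : IsReflProd v) :
    IsReflProd (u * v) := by
  obtain ⟨l, hl, rfl⟩ := hu
  obtain ⟨m, hm, rfl⟩ := hv
  refine ⟨l ++ m, fun r hr => ?_, List.prod_append⟩
  exact (List.mem_append.1 hr).elim (hl r) (hm r)

theorem IsReflProd.inv {n : ℕ} {u : Iso n} (hu : IsReflProd u) : IsReflProd u⁻¹ := by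
  obtain ⟨l, hl, rfl⟩ := hu
  refine ⟨(l.map (·⁻¹)).reverse, fun r hr => ?_, (List.prod_inv_reverse l).symm⟩
  obtain ⟨s, hs, rfl⟩ := List.mem_map.1 (List.mem_reverse.1 hr)
  exact (hl s hs).inv

theorem isReflProd_of_reflLen_ne_zero {n : ℕ} {w : Iso n} (h : reflLen n w ≠ 0) :
    IsReflProd w := by
  obtain ⟨-, l, -, hl, hw⟩ := Nat.nonempty_of_pos_sInf (Nat.pos_of_ne_zero h)
  exact ⟨l, hl, hw⟩

/-- Lower bounds for the reflection length in terms of the dimension of the move-set. -/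
theorem IsReflProd.finrank_moveDir_le {n : ℕ} {u : Iso n} (hu : IsReflProd u) :
    finrank ℝ (moveDir u) ≤ reflLen n u ∧
      ((¬ ∃ x, u x = x) → finrank ℝ (moveDir u) + 2 ≤ reflLen n u) := by
  have hne : {k | ∃ l : List (Iso n), l.length = k ∧ (∀ r ∈ l, IsReflection n r) ∧
      l.prod = u}.Nonempty := by
    obtain ⟨l, hl, hprod⟩ := hu
    exact ⟨l.length, l, rfl, hl, hprod⟩
  obtain ⟨l, hlen, hl, rfl⟩ := Nat.sInf_mem hne
  obtain ⟨S, hS, hdim, hhyp⟩ := exists_submodule_of_prod l hl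
  change l.length = reflLen n l.prod at hlen
  rw [hlen] at hdim hhyp
  refine ⟨(Submodule.finrank_mono (moveDir_le hS)).trans hdim, fun hno => ?_⟩
  have hlt : moveDir l.prod < S := by
    refine lt_of_le_of_ne (moveDir_le hS) fun h => hno ?_
    exact exists_fixed_of_mem_moveDir (x := 0) (h ▸ hS 0)
  have := Submodule.finrank_lt_finrank_of_lt hlt
  have := hhyp hno
  omega

theorem image_add_fixSet {n : ℕ} {u : Iso n} {ν : Euc n} (h : linearPart u ν = ν) :
    (· + ν) '' FixSet n u = FixSet n u := by
  ext x
  simp only [FixSet, Set.mem_image, Set.mem_ofPred_eq]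
  constructor
  · rintro ⟨y, hy, rfl⟩
    rw [apply_add_eq, hy, h]
  · intro hx
    exact ⟨x - ν, by rw [sub_eq_add_neg, apply_add_eq, map_neg, hx, h], sub_add_cancel _ _⟩

theorem linearPart_eq_self_of_image_add_fixSet {n : ℕ} {u : Iso n} {ν a : Euc n} (ha : u a = a)
    (h : (· + ν) '' FixSet n u = FixSet n u) : linearPart u ν = ν := by
  have h1 : u (a + ν) = a + ν := (h ▸ Set.mem_image_of_mem (· + ν) ha : a + ν ∈ FixSet n u)
  rw [apply_add_eq, ha] at h1
  exact add_left_cancel h1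

theorem inner_apply_sub_eq_zero {n : ℕ} {u : Iso n} {ν a : Euc n} (ha : u a = a)
    (h : linearPart u ν = ν) (x : Euc n) : ⟪ν, u x - x⟫ = 0 := by
  have e : u x - x = linearPart u (x - a) - (x - a) := by
    rw [linearPart_sub, ha]; abel
  rw [e]
  exact inner_map_sub_eq_zero _ h _

/-- If the vectors fixed by the linear part form a line, the direction of the move-set is the
orthogonal hyperplane. -/
theorem moveDir_eq_orthogonal {n : ℕ} {w : Iso n} {ν : Euc n}
    (h : ∀ d, linearPart w d = d ↔ d ∈ Submodule.span ℝ {ν}) :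
    moveDir w = (Submodule.span ℝ {ν})ᗮ := by
  apply Submodule.eq_of_le_of_finrank_eq
  · intro d hd
    obtain ⟨z, rfl⟩ := mem_moveDir.1 hd
    rw [Submodule.mem_orthogonal_singleton_iff_inner_right]
    exact inner_map_sub_eq_zero _ ((h ν).2 (Submodule.mem_span_singleton_self ν)) z
  · have hker : LinearMap.ker ((linearPart w).toLinearEquiv.toLinearMap - LinearMap.id) =
        Submodule.span ℝ {ν} := by
      ext d
      rw [← h d]
      simp [sub_eq_zero]
    have h1 := LinearMap.finrank_range_add_finrank_ker
      ((linearPart w).toLinearEquiv.toLinearMap - LinearMap.id)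
    have h2 := (Submodule.span ℝ {ν}).finrank_add_finrank_orthogonal
    rw [hker] at h1
    unfold moveDir
    omega

/-- Coarse structure: let `w` be hyperbolic of maximal reflection
length `n + 1` whose min-set is a line with direction `ν`.  For `u ∈ [1,w]` and
`v = u⁻¹w`: `u` and `v` are not both hyperbolic; if one is hyperbolic the other is
elliptic with fix-set invariant under translation by `ν`; if both are elliptic then
neither fix-set is invariant under translation by `ν`. -/
theorem coarse_structure (n : ℕ) (w : Iso n)
    (hhyp : ¬ ∃ x : Euc n, w x = x)
    (hlen : reflLen n w = n + 1)
    (μ : Euc n) (hμ : μ ∈ MovSet n w) (hmin : ∀ m ∈ MovSet n w, ‖μ‖ ≤ ‖m‖)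
    (p ν : Euc n) (hν : ν ≠ 0)
    (hline : {x : Euc n | w x - x = μ} = {x : Euc n | ∃ s : ℝ, x = p + s • ν}) :
    ∀ u v : Iso n, inInterval n w u → v = u⁻¹ * w →
      (¬ ((¬ ∃ x, u x = x) ∧ (¬ ∃ x, v x = x))) ∧
      ((¬ ∃ x, u x = x) → (∃ x, v x = x) ∧ (· + ν) '' FixSet n v = FixSet n v) ∧
      ((¬ ∃ x, v x = x) → (∃ x, u x = x) ∧ (· + ν) '' FixSet n u = FixSet n u) ∧
      (((∃ x, u x = x) ∧ (∃ x, v x = x)) →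
        ¬ ((· + ν) '' FixSet n u = FixSet n u) ∧
        ¬ ((· + ν) '' FixSet n v = FixSet n v)) := by
  intro u v hu hv
  obtain rfl : w = u * v := by rw [hv, mul_inv_cancel_left]
  have hsum : reflLen n u + reflLen n v = n + 1 := by
    rw [← hlen, ← hu, ← hv]
  have hw : IsReflProd (u * v) := isReflProd_of_reflLen_ne_zero (by omega)
  obtain ⟨hu', hv'⟩ : IsReflProd u ∧ IsReflProd v := by
    by_cases h0 : reflLen n u = 0
    · have h := isReflProd_of_reflLen_ne_zero (w := v) (by omega)
      exact ⟨by simpa using hw.mul h.inv, h⟩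
    · have h := isReflProd_of_reflLen_ne_zero h0
      exact ⟨h, by simpa using h.inv.mul hw⟩
  obtain ⟨hule, huhyp⟩ := hu'.finrank_moveDir_le
  obtain ⟨hvle, hvhyp⟩ := hv'.finrank_moveDir_le
  have hp : (u * v) p - p = μ := by
    have : p ∈ {x : Euc n | ∃ s : ℝ, x = p + s • ν} := ⟨0, by simp⟩
    rwa [← hline] at this
  have hker : ∀ d, linearPart (u * v) d = d ↔ d ∈ Submodule.span ℝ {ν} := by
    intro d
    have h1 : (u * v) (p + d) - (p + d) = μ ↔ linearPart (u * v) d = d := by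
      rw [apply_add_eq, add_sub_add_comm, hp, add_eq_left, sub_eq_zero]
    have h2 := Set.ext_iff.1 hline (p + d)
    simp only [Set.mem_ofPred_eq, add_right_inj] at h2
    rw [← h1, h2, Submodule.mem_span_singleton]
    simp only [eq_comm]
  have hdir := moveDir_eq_orthogonal hker
  have hrank : finrank ℝ (moveDir (u * v)) + 1 = n := by
    have h2 := (Submodule.span ℝ {ν}).finrank_add_finrank_orthogonal
    rw [finrank_span_singleton hν, finrank_euclideanSpace_fin, ← hdir] at h2
    omega
  have hle := moveDir_mul_le u v
  have hle' := Submodule.finrank_mono hle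
  have hsup := Submodule.finrank_add_le_finrank_add_finrank (moveDir u) (moveDir v)
  have hnot : ¬ ((¬ ∃ x, u x = x) ∧ (¬ ∃ x, v x = x)) := by
    rintro ⟨h1, h2⟩
    have := huhyp h1
    have := hvhyp h2
    omega
  have hfix : finrank ℝ (moveDir u) + finrank ℝ (moveDir v) + 1 ≤ n →
      linearPart u ν = ν ∧ linearPart v ν = ν := by
    intro h
    have heq : moveDir u ⊔ moveDir v = (Submodule.span ℝ {ν})ᗮ := by
      rw [← hdir]
      exact (Submodule.eq_of_le_of_finrank_le hle (by omega)).symm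
    constructor <;> apply map_eq_self_of_inner_eq_zero <;>
      rw [← Submodule.mem_orthogonal_singleton_iff_inner_right, ← heq]
    · exact Submodule.mem_sup_left (mem_moveDir.2 ⟨ν, rfl⟩)
    · exact Submodule.mem_sup_right (mem_moveDir.2 ⟨ν, rfl⟩)
  refine ⟨hnot, fun h => ⟨?_, ?_⟩, fun h => ⟨?_, ?_⟩, ?_⟩
  · by_contra h'
    exact hnot ⟨h, h'⟩
  · have := huhyp h
    exact image_add_fixSet (hfix (by omega)).2
  · by_contra h'
    exact hnot ⟨h', h⟩
  · have := hvhyp h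
    exact image_add_fixSet (hfix (by omega)).1
  · rintro ⟨⟨a, ha⟩, b, hb⟩
    have hνfix : linearPart u (linearPart v ν) = ν := by
      rw [← linearPart_mul]
      exact (hker ν).2 (Submodule.mem_span_singleton_self ν)
    have hcontra : linearPart u ν = ν → linearPart v ν = ν → False := by
      intro h1 h2
      apply hhyp
      apply exists_fixed_of_mem_moveDir (x := 0)
      rw [hdir, Submodule.mem_orthogonal_singleton_iff_inner_right, IsometryEquiv.mul_apply,
        ← sub_add_sub_cancel _ (v 0) 0, inner_add_right, inner_apply_sub_eq_zero ha h1,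
        inner_apply_sub_eq_zero hb h2, add_zero]
    constructor <;> intro h
    · have h1 := linearPart_eq_self_of_image_add_fixSet ha h
      exact hcontra h1 ((linearPart u).injective (hνfix.trans h1.symm))
    · have h2 := linearPart_eq_self_of_image_add_fixSet hb h
      rw [h2] at hνfix
      exact hcontra hνfix h2
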